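/- Let T = (T, η, μ) be a monad on Set and F : Set ⥤ Set an endofunctor with a T-algebra lifting F*. Assume a terminal coalgebra (Ω, ω) exists for the endofunctor X ↦ F(T X) and a terminal coalgebra exists for F. Then for every FT-coalgebra (X, f), the unique F-coalgebra morphism from (T X, f♯) to the terminal F-coalgebra factors as ⟦−⟧_{(T X, f♯)} = ⟦−⟧_{(T Ω, ω♯)} ∘ T(⟦−⟧_{(X, f)}), where ⟦−⟧_{(X,f)} : X → Ω is the unique FT-coalgebra morphism into (Ω, ω). -/

import Mathlib

open CategoryTheory CategoryTheory.Limits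

universe u

/-- The carrier of `F*(T.free X)` is `F (T X)`, from the lifting equation. -/
def carrierEq {T : Monad (Type u)} {F : Type u ⥤ Type u}
    {Fstar : Monad.Algebra T ⥤ Monad.Algebra T}
    (hl : Fstar ⋙ T.forget = T.forget ⋙ F) (X : Type u) :
    (Fstar.obj (T.free.obj X)).A = F.obj (T.obj X) :=
  Functor.congr_obj hl (T.free.obj X)

/-- The `T`-algebra structure map `h_X : T (F (T X)) → F (T X)` coming from the lifting. -/
def structMap {T : Monad (Type u)} {F : Type u ⥤ Type u}
    {Fstar : Monad.Algebra T ⥤ Monad.Algebra T}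
    (hl : Fstar ⋙ T.forget = T.forget ⋙ F) (X : Type u) :
    T.obj (F.obj (T.obj X)) ⟶ F.obj (T.obj X) :=
  eqToHom (congrArg T.obj (carrierEq hl X).symm) ≫ (Fstar.obj (T.free.obj X)).a ≫
    eqToHom (carrierEq hl X)

/-- `f♯ = h_X ∘ T f : T X → F (T X)`. -/
def fSharp {T : Monad (Type u)} {F : Type u ⥤ Type u}
    {Fstar : Monad.Algebra T ⥤ Monad.Algebra T}
    (hl : Fstar ⋙ T.forget = T.forget ⋙ F) {X : Type u}
    (f : X ⟶ F.obj (T.obj X)) : T.obj X ⟶ F.obj (T.obj X) :=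
  T.map f ≫ structMap hl X

/-- The structure maps induced by the lifting are natural along `F (T g)`. -/
theorem structMap_naturality {T : Monad (Type u)} {F : Type u ⥤ Type u}
    {Fstar : Monad.Algebra T ⥤ Monad.Algebra T}
    (hl : Fstar ⋙ T.forget = T.forget ⋙ F) {X Y : Type u} (g : X ⟶ Y) :
    structMap hl X ≫ F.map (T.map g) = T.map (F.map (T.map g)) ≫ structMap hl Y := by
  have hF : F.map (T.map g) = eqToHom (carrierEq hl X).symm ≫
      (Fstar.map (T.free.map g)).f ≫ eqToHom (carrierEq hl Y) := by
    have h := Functor.congr_hom hl (T.free.map g)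
    change (Fstar.map (T.free.map g)).f = eqToHom (carrierEq hl X) ≫ F.map (T.map g) ≫
      eqToHom (carrierEq hl Y).symm at h
    rw [h]
    simp
  have h := (Fstar.map (T.free.map g)).h
  rw [hF]
  simp only [structMap, Category.assoc, Functor.map_comp, eqToHom_map, eqToHom_trans_assoc,
    eqToHom_refl, Category.id_comp]
  rw [reassoc_of% h]

/-- Determinization is functorial: `T g` is an `F`-coalgebra morphism `(T X, a♯) → (T Y, b♯)`
whenever `g` is an `FT`-coalgebra morphism `(X, a) → (Y, b)`. -/
theorem fSharp_naturality {T : Monad (Type u)} {F : Type u ⥤ Type u}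
    {Fstar : Monad.Algebra T ⥤ Monad.Algebra T}
    (hl : Fstar ⋙ T.forget = T.forget ⋙ F) {X Y : Type u}
    {a : X ⟶ F.obj (T.obj X)} {b : Y ⟶ F.obj (T.obj Y)} {g : X ⟶ Y}
    (h : a ≫ F.map (T.map g) = g ≫ b) :
    fSharp hl a ≫ F.map (T.map g) = T.map g ≫ fSharp hl b := by
  simp only [fSharp, Category.assoc]
  rw [structMap_naturality, ← Functor.map_comp_assoc, h, Functor.map_comp_assoc]

/-- the final `F`-semantics of the determinization `(T X, f♯)` factors through
`T` applied to the final `FT`-semantics of `(X, f)` followed by the final `F`-semantics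
of the determinization `(T Ω, ω♯)` of the terminal `FT`-coalgebra `(Ω, ω)`. -/
theorem final_map_factorization
    (T : Monad (Type u)) (F : Type u ⥤ Type u)
    (Fstar : Monad.Algebra T ⥤ Monad.Algebra T)
    (hl : Fstar ⋙ T.forget = T.forget ⋙ F)
    [HasTerminal (Endofunctor.Coalgebra (T.toFunctor ⋙ F))]
    [HasTerminal (Endofunctor.Coalgebra F)]
    (X : Type u) (f : X ⟶ F.obj (T.obj X)) :
    (terminal.from (⟨T.obj X, fSharp hl f⟩ : Endofunctor.Coalgebra F)).f
      = T.map (terminal.from (⟨X, f⟩ : Endofunctor.Coalgebra (T.toFunctor ⋙ F))).f ≫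
        (terminal.from
          (⟨T.obj (⊤_ Endofunctor.Coalgebra (T.toFunctor ⋙ F)).V,
            fSharp hl (⊤_ Endofunctor.Coalgebra (T.toFunctor ⋙ F)).str⟩ :
              Endofunctor.Coalgebra F)).f := by
  let C : Endofunctor.Coalgebra (T.toFunctor ⋙ F) := ⟨X, f⟩
  let D : Endofunctor.Coalgebra F := ⟨T.obj X, fSharp hl f⟩
  let E : Endofunctor.Coalgebra F :=
    ⟨T.obj (⊤_ Endofunctor.Coalgebra (T.toFunctor ⋙ F)).V,
      fSharp hl (⊤_ Endofunctor.Coalgebra (T.toFunctor ⋙ F)).str⟩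
  let k : D ⟶ E :=
    { f := T.map (terminal.from C).f
      h := fSharp_naturality hl (terminal.from C).h }
  exact congrArg Endofunctor.Coalgebra.Hom.f (terminal.comp_from k).symm
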